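/- Let Y be a real m×n matrix, Ω a set of index pairs, C > 0, λ > 0, and Θ an m×m real positive definite matrix. If W̄ is the minimizer of the primal objective W ↦ C‖W_Ω − Y_Ω‖² + (1/(2λ)) tr(Wᵀ Θ⁻¹ W) over entrywise-nonnegative m×n matrices, and (Z̄, S̄) is a maximizer of the dual objective D(Z,S) = ⟨Z, Y_Ω⟩ − ‖Z‖²/(4C) − (λ/2) tr((Z+S)ᵀ Θ (Z+S)) over pairs with Z supported on Ω and S entrywise nonnegative, then Z̄ = 2C • (Y_Ω − W̄_Ω). -/

import Mathlib

open Matrix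

open scoped Classical in
/-- The restriction `A_Ω` of a matrix to an index set `Ω`: entries outside `Ω` are set to `0`. -/
noncomputable def restrictM {m n : ℕ} (Ω : Set (Fin m × Fin n))
    (A : Matrix (Fin m) (Fin n) ℝ) : Matrix (Fin m) (Fin n) ℝ :=
  Matrix.of fun i j => if (i, j) ∈ Ω then A i j else 0

theorem trace_transpose_mul_comm {m n : ℕ} (A B : Matrix (Fin m) (Fin n) ℝ) :
    (Aᵀ * B).trace = (Bᵀ * A).trace := by
  rw [← Matrix.trace_transpose, Matrix.transpose_mul, Matrix.transpose_transpose]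

theorem trace_transpose_mul_eq_sum {m n : ℕ} (A B : Matrix (Fin m) (Fin n) ℝ) :
    (Aᵀ * B).trace = ∑ j, ∑ i, A i j * B i j := by
  simp [Matrix.trace, Matrix.mul_apply]

theorem trace_transpose_mul_nonneg {m n : ℕ} {A B : Matrix (Fin m) (Fin n) ℝ}
    (hA : ∀ i j, 0 ≤ A i j) (hB : ∀ i j, 0 ≤ B i j) : 0 ≤ (Aᵀ * B).trace := by
  rw [trace_transpose_mul_eq_sum]
  exact Finset.sum_nonneg fun j _ => Finset.sum_nonneg fun i _ => mul_nonneg (hA i j) (hB i j)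

theorem restrictM_add_smul {m n : ℕ} (Ω : Set (Fin m × Fin n))
    (A B : Matrix (Fin m) (Fin n) ℝ) (t : ℝ) :
    restrictM Ω (A + t • B) = restrictM Ω A + t • restrictM Ω B := by
  ext i j
  by_cases h : (i, j) ∈ Ω <;> simp [restrictM, h]

theorem restrictM_smul_sub {m n : ℕ} (Ω : Set (Fin m × Fin n))
    (A B : Matrix (Fin m) (Fin n) ℝ) (c : ℝ) :
    restrictM Ω (c • (restrictM Ω A - restrictM Ω B)) =
      c • (restrictM Ω A - restrictM Ω B) := by
  ext i j
  by_cases h : (i, j) ∈ Ω <;> simp [restrictM, h]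

theorem trace_restrictM_transpose_mul {m n : ℕ} (Ω : Set (Fin m × Fin n))
    (A B : Matrix (Fin m) (Fin n) ℝ) :
    ((restrictM Ω A)ᵀ * B).trace = (Aᵀ * restrictM Ω B).trace := by
  simp only [trace_transpose_mul_eq_sum]
  refine Finset.sum_congr rfl fun j _ => Finset.sum_congr rfl fun i _ => ?_
  by_cases h : (i, j) ∈ Ω <;> simp [restrictM, h]

/-- Second-order expansion of the quadratic form `A ↦ tr(Aᵀ M A)` for symmetric `M`. -/
theorem trace_quadratic_add_smul {m n : ℕ} {M : Matrix (Fin m) (Fin m) ℝ} (hM : Mᵀ = M)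
    (A B : Matrix (Fin m) (Fin n) ℝ) (t : ℝ) :
    ((A + t • B)ᵀ * M * (A + t • B)).trace =
      (Aᵀ * M * A).trace + 2 * t * (Bᵀ * (M * A)).trace + t ^ 2 * (Bᵀ * M * B).trace := by
  have h : (Aᵀ * M * B).trace = (Bᵀ * (M * A)).trace := by
    rw [← Matrix.trace_transpose, Matrix.transpose_mul, Matrix.transpose_mul, hM,
      Matrix.transpose_transpose]
  simp only [Matrix.transpose_add, Matrix.transpose_smul, Matrix.add_mul, Matrix.mul_add,
    Matrix.smul_mul, Matrix.mul_smul, Matrix.trace_add, Matrix.trace_smul, smul_eq_mul, h,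
    Matrix.mul_assoc Bᵀ M A]
  ring

theorem trace_sq_add_smul {m n : ℕ} (A B : Matrix (Fin m) (Fin n) ℝ) (t : ℝ) :
    ((A + t • B)ᵀ * (A + t • B)).trace =
      (Aᵀ * A).trace + 2 * t * (Bᵀ * A).trace + t ^ 2 * (Bᵀ * B).trace := by
  simpa using trace_quadratic_add_smul (Matrix.transpose_one (n := Fin m) (α := ℝ)) A B t

theorem nonneg_of_forall_mul_add_sq_mul_nonneg {a b : ℝ}
    (h : ∀ t : ℝ, 0 < t → t ≤ 1 → 0 ≤ t * a + t ^ 2 * b) : 0 ≤ a := by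
  by_contra! ha
  have hd : 0 < |b| - a := by linarith [abs_nonneg b]
  have ht : 0 < -a / (2 * (|b| - a)) := by apply div_pos <;> linarith
  have h1 := h _ ht (by rw [div_le_one (by linarith)]; linarith [abs_nonneg b])
  set t := -a / (2 * (|b| - a)) with htd
  have h2 : t * (2 * (|b| - a)) = -a := by rw [htd]; field_simp
  have h3 : 0 ≤ a + t * b := (mul_nonneg_iff_of_pos_left ht).1 (by linarith)
  linarith [mul_le_mul_of_nonneg_left (le_abs_self b) ht.le, mul_pos ht (neg_pos.2 ha)]

/-- First-order optimality of a minimizer of the primal objective along a direction `V`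
that stays feasible. -/
theorem primal_gradient_nonneg {m n : ℕ} (Y : Matrix (Fin m) (Fin n) ℝ)
    (Ω : Set (Fin m × Fin n)) (C l : ℝ) {M : Matrix (Fin m) (Fin m) ℝ} (hM : Mᵀ = M)
    (Wb V : Matrix (Fin m) (Fin n) ℝ)
    (hmin : ∀ W : Matrix (Fin m) (Fin n) ℝ, (∀ i j, 0 ≤ W i j) →
      C * ((restrictM Ω Wb - restrictM Ω Y)ᵀ * (restrictM Ω Wb - restrictM Ω Y)).trace
          + (1 / (2 * l)) * (Wbᵀ * M * Wb).trace ≤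
        C * ((restrictM Ω W - restrictM Ω Y)ᵀ * (restrictM Ω W - restrictM Ω Y)).trace
          + (1 / (2 * l)) * (Wᵀ * M * W).trace)
    (hV : ∀ t : ℝ, 0 < t → t ≤ 1 → ∀ i j, 0 ≤ (Wb + t • V) i j) :
    0 ≤ (Vᵀ * ((1 / l) • (M * Wb) - (2 * C) • (restrictM Ω Y - restrictM Ω Wb))).trace := by
  have key : (Vᵀ * ((1 / l) • (M * Wb) - (2 * C) • (restrictM Ω Y - restrictM Ω Wb))).trace =
      (1 / l) * (Vᵀ * (M * Wb)).trace
        + 2 * C * ((restrictM Ω V)ᵀ * (restrictM Ω Wb - restrictM Ω Y)).trace := by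
    have h : restrictM Ω (restrictM Ω Wb - restrictM Ω Y) = restrictM Ω Wb - restrictM Ω Y := by
      simpa using restrictM_smul_sub Ω Wb Y 1
    rw [trace_restrictM_transpose_mul, h]
    simp only [Matrix.mul_sub, Matrix.mul_smul, Matrix.trace_sub, Matrix.trace_smul, smul_eq_mul]
    ring
  rw [key]
  apply nonneg_of_forall_mul_add_sq_mul_nonneg
    (b := C * ((restrictM Ω V)ᵀ * restrictM Ω V).trace + 1 / (2 * l) * (Vᵀ * M * V).trace)
  intro t ht ht1
  have h := hmin (Wb + t • V) (hV t ht ht1)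
  rw [restrictM_add_smul, add_sub_right_comm, trace_sq_add_smul,
    trace_quadratic_add_smul hM] at h
  have hl : 1 / l = 2 * (1 / (2 * l)) := by rw [one_div, one_div, mul_inv]; ring
  rw [hl]
  linarith

/-- if `W̄` minimizes the primal objective over entrywise-nonnegative
matrices and `(Z̄, S̄)` maximizes the dual objective over pairs with `Z̄` supported on
`Ω` and `S̄` entrywise nonnegative, then `Z̄ = 2C • (Y_Ω − W̄_Ω)`. -/
theorem optimal_dual_Z_eq {m n : ℕ} (Y : Matrix (Fin m) (Fin n) ℝ)
    (Ω : Set (Fin m × Fin n)) (C : ℝ) (hC : 0 < C) (l : ℝ) (hl : 0 < l)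
    (Θ : Matrix (Fin m) (Fin m) ℝ) (hΘ : Θ.PosDef)
    (Wb : Matrix (Fin m) (Fin n) ℝ) (hWb : ∀ i j, 0 ≤ Wb i j)
    (hmin : ∀ W : Matrix (Fin m) (Fin n) ℝ, (∀ i j, 0 ≤ W i j) →
      C * ((restrictM Ω Wb - restrictM Ω Y)ᵀ * (restrictM Ω Wb - restrictM Ω Y)).trace
          + (1 / (2 * l)) * (Wbᵀ * Θ⁻¹ * Wb).trace ≤
        C * ((restrictM Ω W - restrictM Ω Y)ᵀ * (restrictM Ω W - restrictM Ω Y)).trace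
          + (1 / (2 * l)) * (Wᵀ * Θ⁻¹ * W).trace)
    (Zb Sb : Matrix (Fin m) (Fin n) ℝ)
    (hZb : restrictM Ω Zb = Zb) (hSb : ∀ i j, 0 ≤ Sb i j)
    (hmax : ∀ Z S : Matrix (Fin m) (Fin n) ℝ, restrictM Ω Z = Z → (∀ i j, 0 ≤ S i j) →
      (Zᵀ * restrictM Ω Y).trace - (Zᵀ * Z).trace / (4 * C)
          - (l / 2) * ((Z + S)ᵀ * Θ * (Z + S)).trace ≤
        (Zbᵀ * restrictM Ω Y).trace - (Zbᵀ * Zb).trace / (4 * C)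
          - (l / 2) * ((Zb + Sb)ᵀ * Θ * (Zb + Sb)).trace) :
    Zb = (2 * C) • (restrictM Ω Y - restrictM Ω Wb) := by
  have hT : Θᵀ = Θ := by simpa using hΘ.isHermitian.eq
  have hdet : IsUnit Θ.det := (Matrix.isUnit_iff_isUnit_det Θ).1 hΘ.isUnit
  have hTi : (Θ⁻¹)ᵀ = Θ⁻¹ := by rw [Matrix.transpose_nonsing_inv, hT]
  set Z := (2 * C) • (restrictM Ω Y - restrictM Ω Wb) with hZ
  set S := (1 / l) • (Θ⁻¹ * Wb) - Z with hS
  have hS0 : ∀ i j, 0 ≤ S i j := by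
    intro i j
    have h := primal_gradient_nonneg Y Ω C l hTi Wb (Matrix.single i j 1) hmin (by
      intro t ht _ a b
      have : (0 : ℝ) ≤ Matrix.single i j 1 a b := by
        rw [Matrix.single_apply]; split_ifs <;> norm_num
      exact add_nonneg (hWb a b) (mul_nonneg ht.le this))
    rwa [← hZ, ← hS, Matrix.transpose_single, Matrix.trace_single_mul, one_smul] at h
  have hWS : (Wbᵀ * S).trace ≤ 0 := by
    have h := primal_gradient_nonneg Y Ω C l hTi Wb (-Wb) hmin (by
      intro t _ ht1 a b
      have := mul_nonneg (sub_nonneg.2 ht1) (hWb a b)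
      simp only [Matrix.add_apply, Matrix.smul_apply, Matrix.neg_apply, smul_eq_mul]
      linarith)
    rw [Matrix.transpose_neg, Matrix.neg_mul, Matrix.trace_neg] at h
    exact neg_nonneg.1 h
  have hZS : Θ * (Z + S) = (1 / l) • Wb := by
    rw [hS, add_sub_cancel, Matrix.mul_smul, Matrix.mul_nonsing_inv_cancel_left _ _ hdet]
  have h := hmax Z S (restrictM_smul_sub Ω Y Wb (2 * C)) hS0
  obtain ⟨E, hE⟩ : ∃ E, E = Zb - Z := ⟨_, rfl⟩
  obtain ⟨F, hF⟩ : ∃ F, F = Sb - S := ⟨_, rfl⟩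
  have hZb' : Zb = Z + (1 : ℝ) • E := by rw [hE]; simp
  have hsum : Zb + Sb = (Z + S) + (1 : ℝ) • (E + F) := by rw [hE, hF, one_smul]; abel
  have hEr : restrictM Ω E = E := by
    have := restrictM_add_smul Ω Zb Z (-1)
    rw [hZb, restrictM_smul_sub Ω Y Wb (2 * C)] at this
    rwa [neg_one_smul, ← sub_eq_add_neg, ← hE] at this
  have hEW : (Eᵀ * restrictM Ω Wb).trace = (Eᵀ * Wb).trace := by
    rw [← trace_restrictM_transpose_mul, hEr]
  have hEZ : (Eᵀ * Z).trace = 2 * C * ((Eᵀ * restrictM Ω Y).trace - (Eᵀ * Wb).trace) := by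
    rw [hZ, Matrix.mul_smul, Matrix.mul_sub, Matrix.trace_smul, Matrix.trace_sub, hEW,
      smul_eq_mul]
  have hFW : 0 ≤ (Fᵀ * Wb).trace := by
    rw [hF, Matrix.transpose_sub, Matrix.sub_mul, Matrix.trace_sub,
      trace_transpose_mul_comm S Wb]
    linarith [trace_transpose_mul_nonneg hSb hWb]
  have hQ : 0 ≤ ((E + F)ᵀ * Θ * (E + F)).trace := by
    simpa using (hΘ.posSemidef.conjTranspose_mul_mul_same (E + F)).trace_nonneg
  have hlin : (Zbᵀ * restrictM Ω Y).trace =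
      (Zᵀ * restrictM Ω Y).trace + (Eᵀ * restrictM Ω Y).trace := by
    rw [hZb', one_smul, Matrix.transpose_add, Matrix.add_mul, Matrix.trace_add]
  have hsq : (Zbᵀ * Zb).trace / (4 * C) = (Zᵀ * Z).trace / (4 * C)
      + ((Eᵀ * restrictM Ω Y).trace - (Eᵀ * Wb).trace) + (Eᵀ * E).trace / (4 * C) := by
    rw [hZb', trace_sq_add_smul, hEZ]
    field_simp
    ring
  have hquad : l / 2 * ((Zb + Sb)ᵀ * Θ * (Zb + Sb)).trace =
      l / 2 * ((Z + S)ᵀ * Θ * (Z + S)).trace + (Eᵀ * Wb).trace + (Fᵀ * Wb).trace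
        + l / 2 * ((E + F)ᵀ * Θ * (E + F)).trace := by
    rw [hsum, trace_quadratic_add_smul hT, hZS, Matrix.mul_smul, Matrix.trace_smul,
      Matrix.transpose_add E F, Matrix.add_mul, Matrix.trace_add, smul_eq_mul]
    field_simp
    ring
  rw [hlin, hsq, hquad] at h
  have hE0 : (Eᵀ * E).trace / (4 * C) ≤ 0 := by
    linarith [mul_nonneg (half_pos hl).le hQ]
  have hE1 : (Eᵀ * E).trace ≤ 0 := by
    rwa [div_le_iff₀ (by positivity), zero_mul] at hE0
  have hE2 : (Eᵀ * E).trace = 0 := by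
    refine le_antisymm hE1 ?_
    rw [trace_transpose_mul_eq_sum]
    exact Finset.sum_nonneg fun j _ => Finset.sum_nonneg fun i _ => mul_self_nonneg _
  have hE3 : E = 0 := by
    rw [← Matrix.trace_conjTranspose_mul_self_eq_zero_iff]
    simpa using hE2
  rw [hZb', hE3, smul_zero, add_zero]
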